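/- Define f : (0,1) → ℝ by f(ε) = −1/2 + (1 − √ε)/(1 − ε) − ln(2(1 − √ε)/(1 − ε)). Then, as ε → 0⁺, the function ε ↦ f(ε) − [(1/2 − ln 2) + ε/2 − (2/3)·ε^{3/2}] is O(ε²). In particular the leading singular behavior of f near ε = 0 is −(2/3)ε^{3/2}, giving the critical exponent 3/2. -/

import Mathlib

open Asymptotics Filter

noncomputable section

/-- The leading-order free energy of the quartic melonic tensor model in the critical
regime `4Dg² = 1 − ε`: `f(ε) = −1/2 + (1 − √ε)/(1 − ε) − ln(2(1 − √ε)/(1 − ε))`. -/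
def fLO (ε : ℝ) : ℝ :=
  -(1 / 2) + (1 - Real.sqrt ε) / (1 - ε)
    - Real.log (2 * (1 - Real.sqrt ε) / (1 - ε))

/-- As `ε → 0⁺`, `f(ε) = (1/2 − ln 2) + ε/2 − (2/3)ε^{3/2} + O(ε²)`: the leading
singular behavior near criticality is `−(2/3)ε^{3/2}`, i.e. the critical exponent is `3/2`. -/
theorem critical_exponent_three_halves :
    (fun ε : ℝ =>
        fLO ε - ((1 / 2 - Real.log 2) + ε / 2 - (2 / 3) * ε ^ ((3 : ℝ) / 2)))
      =O[nhdsWithin (0 : ℝ) (Set.Ioi 0)] (fun ε : ℝ => ε ^ 2) := by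
  apply IsBigO.of_bound 3
  have hmem : Set.Ioo (0 : ℝ) (1 / 4) ∈ nhdsWithin (0 : ℝ) (Set.Ioi 0) :=
    Ioo_mem_nhdsGT (by norm_num)
  filter_upwards [hmem] with ε hε
  obtain ⟨h0, h1⟩ := hε
  obtain ⟨s, hs, hs0⟩ : ∃ s : ℝ, s = Real.sqrt ε ∧ 0 < s := ⟨_, rfl, Real.sqrt_pos.2 h0⟩
  have hsq : ε = s ^ 2 := by rw [hs, Real.sq_sqrt h0.le]
  have hs1 : s < 1 / 2 := by nlinarith
  have hpow : ε ^ ((3 : ℝ) / 2) = s ^ 3 := by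
    rw [hsq, ← Real.rpow_natCast, ← Real.rpow_natCast, ← Real.rpow_mul hs0.le]
    norm_num
  have hq : (1 - s) / (1 - s ^ 2) = 1 / (1 + s) := by
    have a : 1 - s ≠ 0 := by linarith
    have b : 1 + s ≠ 0 := by linarith
    rw [show 1 - s ^ 2 = (1 - s) * (1 + s) by ring]
    field_simp
  have hl := Real.abs_log_sub_add_sum_range_le (x := -s)
    (by rw [abs_neg, abs_of_pos hs0]; linarith) 3
  have hb : s ^ 4 / (1 - s) ≤ 2 * s ^ 4 := by
    rw [div_le_iff₀ (by linarith)]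
    nlinarith [pow_pos hs0 4]
  have hi : 1 / (1 + s) = 1 - s + s ^ 2 - s ^ 3 + s ^ 4 / (1 + s) := by
    have b : 1 + s ≠ 0 := by linarith
    field_simp
    ring
  have hc0 : 0 ≤ s ^ 4 / (1 + s) := by positivity
  have hc : s ^ 4 / (1 + s) ≤ s ^ 4 := div_le_self (by positivity) (by linarith)
  have hlog : Real.log (2 * (1 - s) / (1 - s ^ 2)) = Real.log 2 - Real.log (1 + s) := by
    rw [mul_div_assoc, hq, mul_one_div, Real.log_div (by norm_num) (by linarith)]
  rw [abs_neg, abs_of_pos hs0, sub_neg_eq_add] at hl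
  norm_num [Finset.sum_range_succ] at hl
  have hl2 := abs_le.1 (hl.trans hb)
  rw [fLO, ← hs, hpow, hsq, hlog, hq, hi, Real.norm_eq_abs, Real.norm_eq_abs,
    abs_of_pos (a := (s ^ 2) ^ 2) (by positivity), abs_le]
  constructor <;> nlinarith [hl2.1, hl2.2]
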